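/- arXiv:1412.1501 — 5 statements merged into one kernel-verified Lean document; each statement's English description precedes it below -/
import Mathlib

section
/- Let (Ω, 𝓕, P) be a probability space, 𝓚 ⊆ 𝓕 a sub-σ-algebra, and V₀, V₁ : Ω → ℝ with E[|V₀ − V₁|] < ∞ and E[V₀ − V₁] > 0. Suppose there exists a nonnegative 𝓚-measurable X with E[X] = E[V₀ − V₁] and E[((V₀ − V₁) − X)²] < ∞. Then there exists a unique λ* ∈ ℝ satisfying E[max(0, E[V₀ − V₁ | 𝓚] − λ*)] = E[V₀ − V₁], and X* := max(0, E[V₀ − V₁ | 𝓚] − λ*) is the unique (up to almost-sure equality) minimizer of E[((V₀ − V₁) − X)²] over all X that are nonnegative, 𝓚-measurable and satisfy either E[X] = E[V₀ − V₁] or X = 0. -/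
open MeasureTheory ProbabilityTheory
open scoped ENNReal

theorem fmi_exists {Ω : Type*} {mΩ : MeasurableSpace Ω} (μ : Measure Ω) [IsProbabilityMeasure μ]
    (K : Ω → ℝ) (hK : Integrable K μ) (c : ℝ) (hc : 0 < c) (hKc : ∫ ω, K ω ∂μ = c) :
    ∃ l : ℝ, 0 ≤ l ∧ ∫ ω, max 0 (K ω - l) ∂μ = c := by
  have hint : ∀ l : ℝ, Integrable (fun ω => max 0 (K ω - l)) μ := fun l =>
    (integrable_zero Ω ℝ μ).sup (hK.sub (integrable_const l))
  have hlim : Filter.Tendsto (fun l : ℝ => ∫ ω, max 0 (K ω - l) ∂μ) Filter.atTop (nhds 0) := by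
    have h := tendsto_integral_filter_of_dominated_convergence (μ := μ) (l := Filter.atTop)
      (F := fun (l : ℝ) ω => max 0 (K ω - l)) (f := fun _ => (0 : ℝ)) (fun ω => |K ω|)
      (Filter.Eventually.of_forall fun l => (hint l).aestronglyMeasurable)
      (by
        filter_upwards [Filter.eventually_ge_atTop (0 : ℝ)] with l hl
        refine Filter.Eventually.of_forall fun ω => ?_
        rw [Real.norm_eq_abs, abs_of_nonneg (le_max_left _ _)]
        exact max_le (abs_nonneg _) (by linarith [le_abs_self (K ω)]))
      hK.abs
      (Filter.Eventually.of_forall fun ω => by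
        refine tendsto_const_nhds.congr' ?_
        filter_upwards [Filter.eventually_ge_atTop (K ω)] with l hl
        rw [max_eq_left (by linarith)])
    simpa using h
  have hcont : Continuous (fun l : ℝ => ∫ ω, max 0 (K ω - l) ∂μ) := by
    have : LipschitzWith 1 (fun l : ℝ => ∫ ω, max 0 (K ω - l) ∂μ) := by
      refine LipschitzWith.of_le_add fun a b => ?_
      have h1 : ∫ ω, max 0 (K ω - a) ∂μ ≤ ∫ ω, (max 0 (K ω - b) + dist a b) ∂μ := by
        refine integral_mono (hint a) ((hint b).add (integrable_const _)) fun ω => ?_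
        have h2 : b - a ≤ dist a b := by
          rw [Real.dist_eq, abs_sub_comm]; exact le_abs_self _
        have h3 : (0 : ℝ) ≤ dist a b := dist_nonneg
        refine max_le (add_nonneg (le_max_left _ _) h3) ?_
        have := le_max_right 0 (K ω - b)
        dsimp only
        linarith
      rw [integral_add (hint b) (integrable_const _)] at h1
      simpa using h1
    exact this.continuous
  obtain ⟨L, hL0, hL⟩ := ((Filter.eventually_ge_atTop (0 : ℝ)).and
    (hlim.eventually (gt_mem_nhds hc))).exists
  have h0 : c ≤ ∫ ω, max 0 (K ω - 0) ∂μ := by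
    rw [← hKc]
    refine integral_mono hK (hint 0) fun ω => ?_
    simp
  obtain ⟨l, hl, hl'⟩ := intermediate_value_Icc' hL0 hcont.continuousOn ⟨hL.le, h0⟩
  exact ⟨l, hl.1, hl'⟩

theorem fmi_unique_aux {Ω : Type*} {mΩ : MeasurableSpace Ω} (μ : Measure Ω)
    [IsProbabilityMeasure μ]
    (K : Ω → ℝ) (hK : Integrable K μ) (c : ℝ) (hc : 0 < c) (a b : ℝ)
    (ha : ∫ ω, max 0 (K ω - a) ∂μ = c) (hb : ∫ ω, max 0 (K ω - b) ∂μ = c) : ¬ a < b := by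
  intro hab
  have hint : ∀ l : ℝ, Integrable (fun ω => max 0 (K ω - l)) μ := fun l =>
    (integrable_zero Ω ℝ μ).sup (hK.sub (integrable_const l))
  have h1 : ∫ ω, (max 0 (K ω - a) - max 0 (K ω - b)) ∂μ = 0 := by
    rw [integral_sub (hint a) (hint b), ha, hb, sub_self]
  rw [integral_eq_zero_iff_of_nonneg
    (fun ω => sub_nonneg.2 (max_le_max le_rfl (by linarith))) ((hint a).sub (hint b))] at h1
  have h2 : ∫ ω, max 0 (K ω - a) ∂μ = 0 := by
    refine integral_eq_zero_of_ae ?_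
    filter_upwards [h1] with ω hω
    simp only [Pi.zero_apply] at hω ⊢
    rcases le_total (K ω) a with h | h
    · exact max_eq_left (by linarith)
    · rw [max_eq_right (by linarith : (0 : ℝ) ≤ K ω - a)] at hω ⊢
      rcases le_total (K ω) b with h' | h'
      · rw [max_eq_left (by linarith : K ω - b ≤ 0)] at hω
        linarith
      · rw [max_eq_right (by linarith : (0 : ℝ) ≤ K ω - b)] at hω
        linarith
  linarith

/-- Second case of Theorem 2 (Fixed Mean Indemnity): if `E[V₀ - V₁] > 0` and there exists
a nonnegative `m`-measurable `X` with `E[X] = E[V₀ - V₁]` and finite risk, then there is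
a unique `λ*` with `E[max(0, E[V₀ - V₁ | m] - λ*)] = E[V₀ - V₁]`, and
`X* = max(0, E[V₀ - V₁ | m] - λ*)` is the unique (up to a.s. equality) minimizer of the
risk over all nonnegative `m`-measurable `X` with `E[X] = E[V₀ - V₁]` or `X = 0`. -/
theorem fixed_mean_indemnity_pos_mean
    {Ω : Type*} {m mΩ : MeasurableSpace Ω} (hm : m ≤ mΩ)
    (μ : Measure Ω) [IsProbabilityMeasure μ] (V₀ V₁ : Ω → ℝ)
    (hInt : Integrable (fun ω => V₀ ω - V₁ ω) μ)
    (hmean : 0 < ∫ ω, V₀ ω - V₁ ω ∂μ)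
    (hex : ∃ X : Ω → ℝ, Measurable[m] X ∧ (∀ ω, 0 ≤ X ω) ∧
      (∫ ω, X ω ∂μ = ∫ ω, V₀ ω - V₁ ω ∂μ) ∧
      Integrable (fun ω => (V₀ ω - V₁ ω - X ω) ^ 2) μ) :
    ∃ l : ℝ,
      (∫ ω, max 0 ((μ[fun ω => V₀ ω - V₁ ω|m]) ω - l) ∂μ = ∫ ω, V₀ ω - V₁ ω ∂μ) ∧
      (∀ l' : ℝ,
        (∫ ω, max 0 ((μ[fun ω => V₀ ω - V₁ ω|m]) ω - l') ∂μ = ∫ ω, V₀ ω - V₁ ω ∂μ) →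
        l' = l) ∧
      (∀ X : Ω → ℝ, Measurable[m] X → (∀ ω, 0 ≤ X ω) →
        ((∫ ω, X ω ∂μ = ∫ ω, V₀ ω - V₁ ω ∂μ) ∨ X = 0) →
        (∫⁻ ω, ENNReal.ofReal
            ((V₀ ω - V₁ ω - max 0 ((μ[fun ω => V₀ ω - V₁ ω|m]) ω - l)) ^ 2) ∂μ ≤
          ∫⁻ ω, ENNReal.ofReal ((V₀ ω - V₁ ω - X ω) ^ 2) ∂μ) ∧
        ((∫⁻ ω, ENNReal.ofReal ((V₀ ω - V₁ ω - X ω) ^ 2) ∂μ =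
            ∫⁻ ω, ENNReal.ofReal
              ((V₀ ω - V₁ ω - max 0 ((μ[fun ω => V₀ ω - V₁ ω|m]) ω - l)) ^ 2) ∂μ) →
          X =ᵐ[μ] fun ω => max 0 ((μ[fun ω => V₀ ω - V₁ ω|m]) ω - l))) := by
  set D : Ω → ℝ := fun ω => V₀ ω - V₁ ω with hD
  set K : Ω → ℝ := μ[D|m] with hKdef
  have hK : Integrable K μ := integrable_condExp
  have hKm : StronglyMeasurable[m] K := stronglyMeasurable_condExp
  have hKc : ∫ ω, K ω ∂μ = ∫ ω, D ω ∂μ := integral_condExp hm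
  obtain ⟨l, hl0, hl⟩ := fmi_exists μ K hK _ hmean hKc
  refine ⟨l, hl, fun l' hl' => ?_, ?_⟩
  · exact le_antisymm (not_lt.1 (fmi_unique_aux μ K hK _ hmean _ _ hl hl'))
      (not_lt.1 (fmi_unique_aux μ K hK _ hmean _ _ hl' hl))
  set S : Ω → ℝ := fun ω => max 0 (K ω - l) with hS
  have hSint : Integrable S μ := (integrable_zero Ω ℝ μ).sup (hK.sub (integrable_const l))
  have hSm : StronglyMeasurable[m] S :=
    (show Continuous (fun t : ℝ => max 0 (t - l)) by fun_prop).comp_stronglyMeasurable hKm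
  have hintX : ∀ X : Ω → ℝ, (∫ ω, X ω ∂μ = ∫ ω, D ω ∂μ) → Integrable X μ := by
    intro X hX
    by_contra h
    rw [integral_undef h] at hX
    linarith
  have hcond : ∀ X : Ω → ℝ, StronglyMeasurable[m] X → Integrable X μ →
      μ[fun ω => D ω - X ω|m] =ᵐ[μ] fun ω => K ω - X ω := by
    intro X hX hXi
    have h := condExp_sub hInt hXi m
    rw [condExp_of_stronglyMeasurable hm hX hXi] at h
    exact h
  -- finite risk of S
  have hS2 : MemLp (fun ω => D ω - S ω) 2 μ := by
    obtain ⟨X, hXm, hX0, hXc, hX2⟩ := hex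
    have hXi := hintX X hXc
    have hDX : MemLp (fun ω => D ω - X ω) 2 μ :=
      (memLp_two_iff_integrable_sq (hInt.sub hXi).aestronglyMeasurable).2 hX2
    have hKX : MemLp (fun ω => K ω - X ω) 2 μ :=
      (memLp_congr_ae (hcond X hXm.stronglyMeasurable hXi)).1 (hDX.condExp one_le_two)
    have hKS : MemLp (fun ω => K ω - S ω) 2 μ := by
      refine MemLp.mono (hKX.abs.add (memLp_const l)) (hK.sub hSint).aestronglyMeasurable
        (Filter.Eventually.of_forall fun ω => ?_)
      have h1 := abs_nonneg (K ω - X ω)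
      have h2 := neg_abs_le (K ω - X ω)
      have h3 := hX0 ω
      simp only [Pi.add_apply, Real.norm_eq_abs, hS]
      refine le_trans ?_ (le_abs_self _)
      change _ ≤ |K ω - X ω| + l
      rcases le_total (K ω) l with h | h
      · rw [max_eq_left (by linarith), abs_le]
        constructor <;> linarith
      · rw [max_eq_right (by linarith), abs_le]
        constructor <;> linarith
    have := (hDX.sub hKX).add hKS
    refine (memLp_congr_ae (Filter.Eventually.of_forall fun ω => ?_)).1 this
    simp only [Pi.add_apply, Pi.sub_apply]
    ring
  have hSfin : ∫⁻ ω, ENNReal.ofReal ((D ω - S ω) ^ 2) ∂μ ≠ ⊤ :=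
    ((hasFiniteIntegral_iff_ofReal (Filter.Eventually.of_forall fun ω => sq_nonneg _)).1
      hS2.integrable_sq.hasFiniteIntegral).ne
  intro X hXm hX0 hXc
  change (∫⁻ ω, ENNReal.ofReal ((D ω - S ω) ^ 2) ∂μ ≤ ∫⁻ ω, ENNReal.ofReal ((D ω - X ω) ^ 2) ∂μ) ∧
    ((∫⁻ ω, ENNReal.ofReal ((D ω - X ω) ^ 2) ∂μ = ∫⁻ ω, ENNReal.ofReal ((D ω - S ω) ^ 2) ∂μ) →
      X =ᵐ[μ] S)
  have hXi : Integrable X μ := by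
    rcases hXc with h | h
    · exact hintX X h
    · rw [h]; exact integrable_zero _ _ _
  have hXle : ∫ ω, X ω ∂μ ≤ ∫ ω, S ω ∂μ := by
    rcases hXc with h | h
    · rw [h]; exact hl.ge
    · rw [h, hl]; simpa using hmean.le
  by_cases hXfin : ∫⁻ ω, ENNReal.ofReal ((D ω - X ω) ^ 2) ∂μ = ⊤
  · rw [hXfin]
    exact ⟨le_top, fun h => absurd h.symm hSfin⟩
  have hDX2 : Integrable (fun ω => (D ω - X ω) ^ 2) μ :=
    ⟨(hInt.sub hXi).aestronglyMeasurable.pow 2,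
      (hasFiniteIntegral_iff_ofReal (Filter.Eventually.of_forall fun ω => sq_nonneg _)).2
        (lt_top_iff_ne_top.2 hXfin)⟩
  have hDX : MemLp (fun ω => D ω - X ω) 2 μ :=
    (memLp_two_iff_integrable_sq (hInt.sub hXi).aestronglyMeasurable).2 hDX2
  have hY : MemLp (fun ω => S ω - X ω) 2 μ := by
    refine (memLp_congr_ae (Filter.Eventually.of_forall fun ω => ?_)).1 (hDX.sub hS2)
    simp only [Pi.sub_apply]
    ring
  have hYm : StronglyMeasurable[m] (fun ω => S ω - X ω) := hSm.sub hXm.stronglyMeasurable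
  have hprod : Integrable (fun ω => (S ω - X ω) * (D ω - S ω)) μ := hY.integrable_mul hS2
  have hpull : μ[fun ω => (S ω - X ω) * (D ω - S ω)|m] =ᵐ[μ]
      fun ω => (S ω - X ω) * (K ω - S ω) := by
    have h := condExp_mul_of_stronglyMeasurable_left hYm hprod (hInt.sub hSint)
    refine h.trans ?_
    filter_upwards [hcond S hSm hSint] with ω hω
    exact congrArg (fun t => (S ω - X ω) * t) hω
  have hcross : 0 ≤ ∫ ω, (S ω - X ω) * (D ω - S ω) ∂μ := by
    rw [← integral_condExp hm, integral_congr_ae hpull]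
    have hi : Integrable (fun ω => (S ω - X ω) * (K ω - S ω)) μ :=
      (integrable_congr hpull).1 integrable_condExp
    have h1 : ∫ ω, (S ω - X ω) * l ∂μ ≤ ∫ ω, (S ω - X ω) * (K ω - S ω) ∂μ := by
      refine integral_mono ((hSint.sub hXi).mul_const l) hi fun ω => ?_
      have h3 := hX0 ω
      simp only [hS]
      rcases le_total (K ω) l with h | h
      · rw [max_eq_left (by linarith)]
        nlinarith
      · rw [max_eq_right (by linarith)]
        nlinarith
    rw [integral_mul_const, integral_sub hSint hXi] at h1
    exact le_trans (mul_nonneg (by linarith) hl0) h1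
  have hkey : ∫ ω, (D ω - X ω) ^ 2 ∂μ = ∫ ω, (D ω - S ω) ^ 2 ∂μ
      + 2 * ∫ ω, (S ω - X ω) * (D ω - S ω) ∂μ + ∫ ω, (S ω - X ω) ^ 2 ∂μ := by
    have hi1 : Integrable (fun ω => (D ω - S ω) ^ 2 + 2 * ((S ω - X ω) * (D ω - S ω))) μ :=
      hS2.integrable_sq.add (hprod.const_mul 2)
    rw [← integral_const_mul, ← integral_add hS2.integrable_sq (hprod.const_mul 2),
      ← integral_add hi1 hY.integrable_sq]
    refine integral_congr_ae (Filter.Eventually.of_forall fun ω => ?_)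
    dsimp only
    ring
  have hY0 : 0 ≤ ∫ ω, (S ω - X ω) ^ 2 ∂μ := integral_nonneg fun ω => sq_nonneg _
  rw [← ofReal_integral_eq_lintegral_ofReal hS2.integrable_sq
      (Filter.Eventually.of_forall fun ω => sq_nonneg _),
    ← ofReal_integral_eq_lintegral_ofReal hDX2
      (Filter.Eventually.of_forall fun ω => sq_nonneg _)]
  refine ⟨ENNReal.ofReal_le_ofReal (by linarith), fun h => ?_⟩
  rw [ENNReal.ofReal_eq_ofReal_iff (integral_nonneg fun ω => sq_nonneg _)
    (integral_nonneg fun ω => sq_nonneg _)] at h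
  have hz : ∫ ω, (S ω - X ω) ^ 2 ∂μ = 0 := by linarith
  rw [integral_eq_zero_iff_of_nonneg (fun ω => sq_nonneg _) hY.integrable_sq] at hz
  filter_upwards [hz] with ω hω
  have h4 : S ω - X ω = 0 := by simpa using hω
  linarith
end

section
/- Let (Ω, 𝓕, P) be a probability space, 𝓚 ⊆ 𝓕 a sub-σ-algebra, and V₀, V₁ : Ω → ℝ with E[|V₀ − V₁|] < ∞ and E[V₀ − V₁] > 0. Then there exists a unique λ* ∈ ℝ such that E[max(0, ΔV_𝓚 − λ*)] = E[V₀ − V₁], where ΔV_𝓚 = E[V₀ − V₁ | 𝓚]. -/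
open MeasureTheory ProbabilityTheory

theorem aux_unique_level {Ω : Type*} {mΩ : MeasurableSpace Ω}
    (μ : Measure Ω) [IsProbabilityMeasure μ] (X : Ω → ℝ) (hX : Integrable X μ)
    (c : ℝ) (hc : 0 < c) (hXc : ∫ ω, X ω ∂μ = c) :
    ∃! l : ℝ, ∫ ω, max 0 (X ω - l) ∂μ = c := by
  have hi : ∀ l : ℝ, Integrable (fun ω => max 0 (X ω - l)) μ := fun l =>
    (integrable_zero Ω ℝ μ).sup (hX.sub (integrable_const l))
  have hcont : Continuous (fun l : ℝ => ∫ ω, max 0 (X ω - l) ∂μ) := by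
    refine (LipschitzWith.of_le_add (f := fun l : ℝ => ∫ ω, max 0 (X ω - l) ∂μ) ?_).continuous
    intro a b
    have h1 : ∫ ω, (max 0 (X ω - b) + dist a b) ∂μ = ∫ ω, max 0 (X ω - b) ∂μ + dist a b := by
      rw [integral_add (hi b) (integrable_const _)]; simp
    change ∫ ω, max 0 (X ω - a) ∂μ ≤ ∫ ω, max 0 (X ω - b) ∂μ + dist a b
    rw [← h1]
    refine integral_mono (hi a) ((hi b).add (integrable_const _)) fun ω => ?_
    have h2 := neg_abs_le (a - b)
    have h3 := abs_nonneg (a - b)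
    simp only [Real.dist_eq]
    refine max_le ?_ ?_
    · have := le_max_left 0 (X ω - b)
      linarith
    · have := le_max_right 0 (X ω - b)
      linarith
  have hlim : Filter.Tendsto (fun n : ℕ => ∫ ω, max 0 (X ω - n) ∂μ) Filter.atTop (nhds 0) := by
    have := tendsto_integral_of_dominated_convergence (μ := μ)
      (F := fun (n : ℕ) ω => max 0 (X ω - n)) (f := fun _ => (0 : ℝ)) (fun ω => |X ω|)
      (fun n => (hi n).aestronglyMeasurable) hX.abs ?_ ?_
    · simpa using this
    · intro n
      refine Filter.Eventually.of_forall fun ω => ?_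
      rw [Real.norm_eq_abs, abs_of_nonneg (le_max_left _ _)]
      have h1 : (0 : ℝ) ≤ n := n.cast_nonneg
      exact max_le (abs_nonneg _) (by linarith [le_abs_self (X ω)])
    · refine Filter.Eventually.of_forall fun ω => ?_
      obtain ⟨N, hN⟩ := exists_nat_ge (X ω)
      refine tendsto_const_nhds.congr' ?_
      filter_upwards [Filter.eventually_ge_atTop N] with n hn
      have h1 : (N : ℝ) ≤ n := by exact_mod_cast hn
      exact (max_eq_left (by linarith)).symm
  have h0 : c ≤ ∫ ω, max 0 (X ω - 0) ∂μ := by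
    rw [← hXc]
    refine integral_mono hX (hi 0) fun ω => ?_
    simp
  obtain ⟨n, hn⟩ := (hlim.eventually (gt_mem_nhds hc)).exists
  obtain ⟨l, -, hl⟩ := intermediate_value_Icc' (n.cast_nonneg : (0 : ℝ) ≤ n)
    hcont.continuousOn ⟨hn.le, h0⟩
  have key : ∀ a b : ℝ, a < b → ∫ ω, max 0 (X ω - a) ∂μ = c →
      ∫ ω, max 0 (X ω - b) ∂μ = c → False := by
    intro a b hab ha hb
    have h1 : ∫ ω, (max 0 (X ω - a) - max 0 (X ω - b)) ∂μ = 0 := by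
      rw [integral_sub (hi a) (hi b), ha, hb, sub_self]
    have h2 := (integral_eq_zero_iff_of_nonneg (fun ω => by
      have : max 0 (X ω - b) ≤ max 0 (X ω - a) := max_le_max le_rfl (by linarith)
      simpa using this) ((hi a).sub (hi b))).1 h1
    have h3 : ∫ ω, max 0 (X ω - a) ∂μ = 0 := by
      refine integral_eq_zero_of_ae ?_
      filter_upwards [h2] with ω hω
      simp only [Pi.zero_apply, Pi.sub_apply] at hω ⊢
      refine max_eq_left ?_
      by_contra! hpos
      rw [max_eq_right hpos.le] at hω
      rcases max_cases 0 (X ω - b) with h | h <;> linarith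
    linarith
  refine ⟨l, hl, fun y hy => ?_⟩
  rcases lt_trichotomy y l with h | h | h
  · exact (key _ _ h hy hl).elim
  · exact h
  · exact (key _ _ h hl hy).elim

/-- Lemma 2 of the appendix: if `E[|V₀ - V₁|] < ∞` and `E[V₀ - V₁] > 0`, then there is a
unique `λ* ∈ ℝ` such that `E[max(0, ΔV_𝓚 - λ*)] = E[V₀ - V₁]`, with
`ΔV_𝓚 = E[V₀ - V₁ | m]`. -/
theorem exists_unique_lambda_star
    {Ω : Type*} {m mΩ : MeasurableSpace Ω} (hm : m ≤ mΩ)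
    (μ : Measure Ω) [IsProbabilityMeasure μ] (V₀ V₁ : Ω → ℝ)
    (hInt : Integrable (fun ω => V₀ ω - V₁ ω) μ)
    (hmean : 0 < ∫ ω, V₀ ω - V₁ ω ∂μ) :
    ∃! l : ℝ,
      ∫ ω, max 0 ((μ[fun ω => V₀ ω - V₁ ω|m]) ω - l) ∂μ = ∫ ω, V₀ ω - V₁ ω ∂μ := by
  exact aux_unique_level μ _ integrable_condExp _ hmean (integral_condExp hm)
end

section
/- Let (Ω, 𝓕, P) be a probability space, 𝓚 ⊆ 𝓕 a sub-σ-algebra, and V₀, V₁ : Ω → ℝ with E[|V₀ − V₁|] < ∞. Let X₁* = max(0, ΔV_𝓚) where ΔV_𝓚 = E[V₀ − V₁ | 𝓚]. Then for every nonnegative 𝓚-measurable random variable X with E[((V₀ − V₁) − X)²] < ∞, one has R(X) − R(X₁*) ≥ E[(X − X₁*)²], where R(Y) = E[((V₀ − V₁) − Y)²]. -/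
open MeasureTheory ProbabilityTheory

/-- Main inequality chain in the proof of Theorem 1: with `X₁* = max(0, E[V₀ - V₁ | m])`,
every nonnegative `m`-measurable `X` with finite risk satisfies
`R(X) - R(X₁*) ≥ E[(X - X₁*)²]`. -/
theorem risk_gap_ge_square_distance
    {Ω : Type*} {m mΩ : MeasurableSpace Ω} (hm : m ≤ mΩ)
    (μ : Measure Ω) [IsProbabilityMeasure μ] (V₀ V₁ : Ω → ℝ)
    (hInt : Integrable (fun ω => V₀ ω - V₁ ω) μ)
    (X : Ω → ℝ) (hXmeas : Measurable[m] X) (hXnonneg : ∀ ω, 0 ≤ X ω)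
    (hRX : Integrable (fun ω => (V₀ ω - V₁ ω - X ω) ^ 2) μ) :
    ∫ ω, (X ω - max 0 ((μ[fun ω => V₀ ω - V₁ ω|m]) ω)) ^ 2 ∂μ ≤
      (∫ ω, (V₀ ω - V₁ ω - X ω) ^ 2 ∂μ) -
        ∫ ω, (V₀ ω - V₁ ω - max 0 ((μ[fun ω => V₀ ω - V₁ ω|m]) ω)) ^ 2 ∂μ := by
  set D : Ω → ℝ := fun ω => V₀ ω - V₁ ω with hD
  set C : Ω → ℝ := μ[D|m] with hC
  set W : Ω → ℝ := D - X with hW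
  set H : Ω → ℝ := fun ω => X ω - max 0 (C ω) with hH
  have hXsm : StronglyMeasurable[m] X := hXmeas.stronglyMeasurable
  have hCsm : StronglyMeasurable[m] C := stronglyMeasurable_condExp
  have hHsm : StronglyMeasurable[m] H :=
    (hXmeas.sub (Measurable.max (measurable_const (a := (0:ℝ))) hCsm.measurable)).stronglyMeasurable
  have hWm : AEStronglyMeasurable W μ :=
    hInt.aestronglyMeasurable.sub (hXsm.mono hm).aestronglyMeasurable
  have hW2 : MemLp W 2 μ := (memLp_two_iff_integrable_sq hWm).2 hRX
  have hWi : Integrable W μ := hW2.integrable (by norm_num)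
  have hXi : Integrable X μ := by
    have := hInt.sub hWi
    simpa [hW] using this
  have hZ : μ[W|m] =ᵐ[μ] fun ω => C ω - X ω := by
    have h1 := condExp_sub hInt hXi m
    rw [condExp_of_stronglyMeasurable hm hXsm hXi] at h1
    exact h1
  have hZ2 : MemLp (μ[W|m]) 2 μ := hW2.condExp (by norm_num)
  have hH2 : MemLp H 2 μ := by
    refine hZ2.mono (hHsm.mono hm).aestronglyMeasurable ?_
    filter_upwards [hZ] with ω hω
    rw [hω, Real.norm_eq_abs, Real.norm_eq_abs]
    have := hXnonneg ω
    rcases le_total 0 (C ω) with h | h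
    · simp only [hH, max_eq_right h]; rw [abs_sub_comm]
    · simp only [hH, max_eq_left h]
      rw [abs_of_nonneg (by linarith), abs_of_nonpos (by linarith)]; linarith
  have hWH : Integrable (W * H) μ := hW2.integrable_mul hH2
  have hHH : Integrable (fun ω => H ω ^ 2) μ := hH2.integrable_sq
  have hpull : μ[W * H|m] =ᵐ[μ] μ[W|m] * H :=
    condExp_mul_of_stronglyMeasurable_right hHsm hWH hWi
  have hZH : Integrable (μ[W|m] * H) μ := hZ2.integrable_mul hH2
  have e1 : ∫ ω, (W * H) ω ∂μ = ∫ ω, (μ[W|m] * H) ω ∂μ := by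
    rw [← integral_condExp hm (f := W * H)]
    exact integral_congr_ae hpull
  have e2 : ∫ ω, (μ[W|m] * H) ω ∂μ + ∫ ω, H ω ^ 2 ∂μ ≤ 0 := by
    rw [← integral_add hZH hHH]
    refine integral_nonpos_of_ae ?_
    filter_upwards [hZ] with ω hω
    simp only [Pi.mul_apply, hω, Pi.zero_apply]
    have := hXnonneg ω
    rcases le_total 0 (C ω) with h | h
    · simp only [hH, max_eq_right h]; nlinarith
    · simp only [hH, max_eq_left h]; nlinarith
  have e3 : ∫ ω, (D ω - max 0 (C ω)) ^ 2 ∂μ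
      = ∫ ω, (D ω - X ω) ^ 2 ∂μ + (2 * ∫ ω, (W * H) ω ∂μ + ∫ ω, H ω ^ 2 ∂μ) := by
    rw [← integral_const_mul, ← integral_add (hWH.const_mul 2) hHH]
    have hA : Integrable (fun ω => (D ω - X ω) ^ 2) μ := hRX
    have hB : Integrable (fun ω => 2 * (W * H) ω + H ω ^ 2) μ := (hWH.const_mul 2).add hHH
    rw [← integral_add hA hB]
    congr 1
    ext ω
    simp only [hW, hH, Pi.mul_apply, Pi.sub_apply]
    ring
  change ∫ ω, H ω ^ 2 ∂μ ≤ ∫ ω, (D ω - X ω) ^ 2 ∂μ - ∫ ω, (D ω - max 0 (C ω)) ^ 2 ∂μ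
  linarith
end

section
/- Let (Ω, 𝓕, P) be a probability space, 𝓚 ⊆ 𝓕 a sub-σ-algebra, and V₀, V₁ : Ω → ℝ with E[|V₀ − V₁|] < ∞ and E[V₀ − V₁] > 0. Let λ* be the unique real number with E[max(0, ΔV_𝓚 − λ*)] = E[V₀ − V₁], where ΔV_𝓚 = E[V₀ − V₁ | 𝓚]. Then λ* ≥ 0, and consequently the Fixed Mean Indemnity compensation max(0, ΔV_𝓚 − λ*) is almost surely less than or equal to the Closest to Counterfactual compensation max(0, ΔV_𝓚). -/
open MeasureTheory ProbabilityTheory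

/-- If `E[V₀ - V₁] > 0` and `λ*` satisfies `E[max(0, ΔV_𝓚 - λ*)] = E[V₀ - V₁]` with
`ΔV_𝓚 = E[V₀ - V₁ | m]`, then `λ* ≥ 0`, and consequently the Fixed Mean Indemnity
compensation `max(0, ΔV_𝓚 - λ*)` is almost surely at most the Closest to Counterfactual
compensation `max(0, ΔV_𝓚)`. -/
theorem fixed_mean_le_closest_to_counterfactual
    {Ω : Type*} {m mΩ : MeasurableSpace Ω} (hm : m ≤ mΩ)
    (μ : Measure Ω) [IsProbabilityMeasure μ] (V₀ V₁ : Ω → ℝ)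
    (hInt : Integrable (fun ω => V₀ ω - V₁ ω) μ)
    (hmean : 0 < ∫ ω, V₀ ω - V₁ ω ∂μ) (lstar : ℝ)
    (hlstar : ∫ ω, max 0 ((μ[fun ω => V₀ ω - V₁ ω|m]) ω - lstar) ∂μ =
      ∫ ω, V₀ ω - V₁ ω ∂μ)
    (huniq : ∀ l : ℝ,
      (∫ ω, max 0 ((μ[fun ω => V₀ ω - V₁ ω|m]) ω - l) ∂μ = ∫ ω, V₀ ω - V₁ ω ∂μ) →
      l = lstar) :
    0 ≤ lstar ∧
    ∀ᵐ ω ∂μ, max 0 ((μ[fun ω => V₀ ω - V₁ ω|m]) ω - lstar) ≤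
      max 0 ((μ[fun ω => V₀ ω - V₁ ω|m]) ω) := by
  have hc : Integrable (μ[fun ω => V₀ ω - V₁ ω|m]) μ := integrable_condExp
  have hE := integral_condExp (μ := μ) (f := fun ω => V₀ ω - V₁ ω) hm
  have hs : Integrable (fun ω => (μ[fun ω => V₀ ω - V₁ ω|m]) ω - lstar) μ :=
    hc.sub (integrable_const lstar)
  have hmax : Integrable (fun ω => max 0 ((μ[fun ω => V₀ ω - V₁ ω|m]) ω - lstar)) μ :=
    (integrable_const (0 : ℝ)).sup hs
  have hle : ∫ ω, ((μ[fun ω => V₀ ω - V₁ ω|m]) ω - lstar) ∂μ ≤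
      ∫ ω, max 0 ((μ[fun ω => V₀ ω - V₁ ω|m]) ω - lstar) ∂μ :=
    integral_mono hs hmax (fun ω => le_max_right _ _)
  rw [integral_sub hc (integrable_const lstar), hE, hlstar] at hle
  have hl : 0 ≤ lstar := by
    simp only [integral_const, probReal_univ, smul_eq_mul, one_mul] at hle
    linarith
  exact ⟨hl, Filter.Eventually.of_forall fun ω => max_le_max le_rfl (by linarith)⟩
end

section
/- Let (Ω, 𝓕, P) be a probability space, 𝓚 ⊆ 𝓕 a sub-σ-algebra, and V₀, V₁ : Ω → ℝ with E[|V₀ − V₁|] < ∞ and E[V₀ − V₁] > 0. Let λ* be the unique real with E[max(0, ΔV_𝓚 − λ*)] = E[V₀ − V₁] and set X₂⁺ = max(0, ΔV_𝓚 − λ*), where ΔV_𝓚 = E[V₀ − V₁ | 𝓚]. Then for every nonnegative 𝓚-measurable random variable X with E[X] = E[V₀ − V₁] and E[((V₀ − V₁) − X)²] < ∞, one has R(X) − R(X₂⁺) ≥ Var[X − X₂⁺], where R(Y) = E[((V₀ − V₁) − Y)²] and Var denotes variance. -/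
open MeasureTheory ProbabilityTheory

/-- Main inequality chain in the proof of Theorem 2: with `X₂⁺ = max(0, ΔV_𝓚 - λ*)`,
where `λ*` solves `E[max(0, ΔV_𝓚 - λ*)] = E[V₀ - V₁] > 0`, every nonnegative
`m`-measurable `X` with `E[X] = E[V₀ - V₁]` and finite risk satisfies
`R(X) - R(X₂⁺) ≥ Var[X - X₂⁺]`. -/
theorem risk_gap_ge_variance
    {Ω : Type*} {m mΩ : MeasurableSpace Ω} (hm : m ≤ mΩ)
    (μ : Measure Ω) [IsProbabilityMeasure μ] (V₀ V₁ : Ω → ℝ)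
    (hInt : Integrable (fun ω => V₀ ω - V₁ ω) μ)
    (hmean : 0 < ∫ ω, V₀ ω - V₁ ω ∂μ) (lstar : ℝ)
    (hlstar : ∫ ω, max 0 ((μ[fun ω => V₀ ω - V₁ ω|m]) ω - lstar) ∂μ =
      ∫ ω, V₀ ω - V₁ ω ∂μ)
    (huniq : ∀ l : ℝ,
      (∫ ω, max 0 ((μ[fun ω => V₀ ω - V₁ ω|m]) ω - l) ∂μ = ∫ ω, V₀ ω - V₁ ω ∂μ) →
      l = lstar)
    (X : Ω → ℝ) (hXmeas : Measurable[m] X) (hXnonneg : ∀ ω, 0 ≤ X ω)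
    (hXmean : ∫ ω, X ω ∂μ = ∫ ω, V₀ ω - V₁ ω ∂μ)
    (hRX : Integrable (fun ω => (V₀ ω - V₁ ω - X ω) ^ 2) μ) :
    variance (fun ω => X ω - max 0 ((μ[fun ω => V₀ ω - V₁ ω|m]) ω - lstar)) μ ≤
      (∫ ω, (V₀ ω - V₁ ω - X ω) ^ 2 ∂μ) -
        ∫ ω, (V₀ ω - V₁ ω - max 0 ((μ[fun ω => V₀ ω - V₁ ω|m]) ω - lstar)) ^ 2 ∂μ := by
  set D : Ω → ℝ := fun ω => V₀ ω - V₁ ω with hD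
  set M : Ω → ℝ := μ[D|m] with hM
  set Y : Ω → ℝ := fun ω => max 0 (M ω - lstar) with hY
  change variance (fun ω => X ω - Y ω) μ ≤ (∫ ω, (D ω - X ω) ^ 2 ∂μ) - ∫ ω, (D ω - Y ω) ^ 2 ∂μ
  have hMm : StronglyMeasurable[m] M := stronglyMeasurable_condExp
  have hXm : StronglyMeasurable[m] X := hXmeas.stronglyMeasurable
  have hYm : StronglyMeasurable[m] Y :=
    (measurable_const.max (hMm.measurable.sub measurable_const)).stronglyMeasurable
  have hXa : AEStronglyMeasurable X μ := (hXm.mono hm).aestronglyMeasurable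
  have hYa : AEStronglyMeasurable Y μ := (hYm.mono hm).aestronglyMeasurable
  have hMi : Integrable M μ := integrable_condExp
  have hDX : MemLp (fun ω => D ω - X ω) 2 μ :=
    (memLp_two_iff_integrable_sq (hInt.aestronglyMeasurable.sub hXa)).2 hRX
  have hXi : Integrable X μ := by
    have h := hInt.sub (hDX.integrable one_le_two)
    refine h.congr (Filter.Eventually.of_forall fun ω => ?_)
    simp
  have hYi : Integrable Y μ := (integrable_const 0).sup (hMi.sub (integrable_const lstar))
  have hMX : MemLp (fun ω => M ω - X ω) 2 μ := by
    have h := hDX.condExp (m := m) one_le_two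
    refine (memLp_congr_ae ?_).1 h
    have h2 := condExp_sub hInt hXi m
    rw [condExp_of_stronglyMeasurable hm hXm hXi] at h2
    exact h2
  have hXY : MemLp (fun ω => X ω - Y ω) 2 μ := by
    refine (hMX.sub (memLp_const lstar)).of_le (hXa.sub hYa) (Filter.Eventually.of_forall fun ω => ?_)
    simp only [Real.norm_eq_abs, Pi.sub_apply, hY]
    have hx := hXnonneg ω
    rcases max_cases 0 (M ω - lstar) with ⟨h, h'⟩ | ⟨h, h'⟩ <;> rw [h]
    · rw [abs_of_nonneg (by linarith)]
      rw [abs_of_nonpos (by linarith)]; linarith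
    · rw [abs_sub_comm]; apply le_of_eq; congr 1; ring
  have hDM : MemLp (fun ω => D ω - M ω) 2 μ := by
    convert hDX.sub hMX using 1
    ext ω; simp
  have hDY : MemLp (fun ω => D ω - Y ω) 2 μ := by
    convert hDX.add hXY using 1
    ext ω; simp
  have hprod : Integrable ((fun ω => X ω - Y ω) * (fun ω => D ω - M ω)) μ :=
    hXY.integrable_mul hDM
  have horth : ∫ ω, (X ω - Y ω) * (D ω - M ω) ∂μ = 0 := by
    have h1 := condExp_mul_of_stronglyMeasurable_left (m := m) (hXm.sub hYm) hprod
      (hInt.sub hMi)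
    have h2 := condExp_sub hInt hMi m
    rw [condExp_of_stronglyMeasurable hm hMm hMi] at h2
    have h3 := integral_condExp (μ := μ) (f := (fun ω => X ω - Y ω) * (fun ω => D ω - M ω)) hm
    change _ = ∫ ω, (X ω - Y ω) * (D ω - M ω) ∂μ at h3
    rw [← h3]
    apply integral_eq_zero_of_ae
    filter_upwards [h1, h2] with ω a b
    refine a.trans ?_
    have b' : (μ[fun ω => D ω - M ω|m]) ω = 0 := by
      refine b.trans ?_
      simp [hM]
    simp [b']
  have hmz : ∫ ω, (X ω - Y ω) ∂μ = 0 := by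
    rw [integral_sub hXi hYi, hXmean, hlstar, sub_self]
  rw [variance_of_integral_eq_zero hXY.aestronglyMeasurable.aemeasurable hmz]
  have hA := hXY.integrable_sq
  have hB := hDY.integrable_sq
  have hC := hDX.integrable_sq
  have hprod' : Integrable (fun ω => (X ω - Y ω) * (D ω - M ω)) μ := hprod
  have hZ : Integrable (fun ω => X ω - Y ω) μ := hXi.sub hYi
  have hE : Integrable (fun ω => 2 * ((X ω - Y ω) * (D ω - M ω)) + 2 * lstar * (X ω - Y ω)) μ :=
    (hprod'.const_mul 2).add (hZ.const_mul (2 * lstar))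
  have key : ∫ ω, ((X ω - Y ω) ^ 2 + (D ω - Y ω) ^ 2) ∂μ ≤
      ∫ ω, ((D ω - X ω) ^ 2 + (2 * ((X ω - Y ω) * (D ω - M ω)) + 2 * lstar * (X ω - Y ω))) ∂μ := by
    refine integral_mono (hA.add hB)
      (hC.add ((hprod'.const_mul 2).add (hZ.const_mul (2 * lstar)))) fun ω => ?_
    have hx := hXnonneg ω
    simp only [hY]
    rcases max_cases 0 (M ω - lstar) with ⟨h, h'⟩ | ⟨h, h'⟩ <;> rw [h]
    · nlinarith [mul_nonneg hx (sub_nonneg.2 h')]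
    · nlinarith
  rw [integral_add hA hB, integral_add hC hE,
    integral_add (hprod'.const_mul 2) (hZ.const_mul (2 * lstar)), integral_const_mul,
    integral_const_mul, horth, hmz] at key
  linarith
end
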